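/- ((−)-discrete Lagrange–d'Alembert–Pontryagin principle.) Let N ≥ 1, let q₀,…,q_N, v₁,…,v_N ∈ ℝⁿ and p₀,…,p_{N−1} ∈ (ℝⁿ)*, and assume (v_{k+1}, q_{k+1}) ∈ Δ^{d−} for k = 0,…,N−1. Then the following are equivalent: (a) for every δq₀,…,δq_N ∈ ℝⁿ with δq_k ∈ Δ(q_k) for all k and δq₀ = δq_N = 0, every δv₁,…,δv_N ∈ ℝⁿ, and every δp₀,…,δp_{N−1} ∈ (ℝⁿ)*, the function ε ↦ Σ_{k=0}^{N−1} [ L_d(v_{k+1} + ε δv_{k+1}, q_{k+1} + ε δq_{k+1}) + (p_k + ε δp_k)(v_{k+1} + ε δv_{k+1} − q_k − ε δq_k) ] has derivative 0 at ε = 0; (b) p_k = −D₁L_d(v_{k+1}, q_{k+1}) and v_{k+1} = q_k for k = 0,…,N−1, and p_{k+1} − D₂L_d(v_{k+1}, q_{k+1}) ∈ Δ°(q_{k+1}) for k = 0,…,N−2. -/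

import Mathlib

open scoped BigOperators

/-- Partial Fréchet derivative of `L : ℝⁿ × ℝⁿ → ℝ` with respect to the
first argument, as a continuous linear functional on `ℝⁿ`. -/
noncomputable def D1 {n : ℕ} (L : (Fin n → ℝ) × (Fin n → ℝ) → ℝ)
    (a b : Fin n → ℝ) : (Fin n → ℝ) →L[ℝ] ℝ :=
  fderiv ℝ (fun x => L (x, b)) a

/-- Partial Fréchet derivative of `L : ℝⁿ × ℝⁿ → ℝ` with respect to the
second argument, as a continuous linear functional on `ℝⁿ`. -/
noncomputable def D2 {n : ℕ} (L : (Fin n → ℝ) × (Fin n → ℝ) → ℝ)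
    (a b : Fin n → ℝ) : (Fin n → ℝ) →L[ℝ] ℝ :=
  fderiv ℝ (fun y => L (a, y)) b

/-- The annihilator `Δ°(q)` of the constraint distribution at `q`. -/
def ann {n : ℕ} (Δ : (Fin n → ℝ) → Submodule ℝ (Fin n → ℝ)) (q : Fin n → ℝ) :
    Set ((Fin n → ℝ) →L[ℝ] ℝ) :=
  {φ | ∀ v ∈ Δ q, φ v = 0}

/-- The (+)-discrete constraint space `Δ^{d+} = {(q₀,q₁) : (q₁−q₀)/h ∈ Δ(q₁)}`. -/
def dPlus {n : ℕ} (h : ℝ) (Δ : (Fin n → ℝ) → Submodule ℝ (Fin n → ℝ)) :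
    Set ((Fin n → ℝ) × (Fin n → ℝ)) :=
  {P | h⁻¹ • (P.2 - P.1) ∈ Δ P.2}

/-- The (−)-discrete constraint space `Δ^{d−} = {(q₀,q₁) : (q₁−q₀)/h ∈ Δ(q₀)}`. -/
def dMinus {n : ℕ} (h : ℝ) (Δ : (Fin n → ℝ) → Submodule ℝ (Fin n → ℝ)) :
    Set ((Fin n → ℝ) × (Fin n → ℝ)) :=
  {P | h⁻¹ • (P.2 - P.1) ∈ Δ P.1}

theorem aux_term {n : ℕ} (L : (Fin n → ℝ) × (Fin n → ℝ) → ℝ) (hL : Differentiable ℝ L)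
    (a b c w x y : Fin n → ℝ) (p r : (Fin n → ℝ) →L[ℝ] ℝ) :
    HasDerivAt (fun ε : ℝ => L (a + ε • w, b + ε • x) + (p + ε • r) (a + ε • w - c - ε • y))
      (D1 L a b w + D2 L a b x + r (a - c) + p (w - y)) 0 := by
  have hl : ∀ u z : Fin n → ℝ, HasDerivAt (fun ε : ℝ => u + ε • z) z 0 := by
    intro u z
    simpa using ((hasDerivAt_id (0 : ℝ)).smul_const z).const_add u
  have hF : HasFDerivAt L (fderiv ℝ L (a, b)) (a, b) := (hL (a, b)).hasFDerivAt
  have h1 : D1 L a b = (fderiv ℝ L (a, b)).comp (ContinuousLinearMap.inl ℝ _ _) :=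
    (hF.comp a (hasFDerivAt_prodMk_left a b)).fderiv
  have h2 : D2 L a b = (fderiv ℝ L (a, b)).comp (ContinuousLinearMap.inr ℝ _ _) :=
    (hF.comp b (hasFDerivAt_prodMk_right a b)).fderiv
  have hA : HasDerivAt (fun ε : ℝ => L (a + ε • w, b + ε • x)) (D1 L a b w + D2 L a b x) 0 := by
    have hF' : HasFDerivAt L (fderiv ℝ L (a, b)) (a + (0 : ℝ) • w, b + (0 : ℝ) • x) := by
      simpa using hF
    have := hF'.comp_hasDerivAt (0 : ℝ) ((hl a w).prodMk (hl b x))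
    have e : D1 L a b w + D2 L a b x = fderiv ℝ L (a, b) (w, x) := by
      rw [h1, h2]
      simp only [ContinuousLinearMap.comp_apply, ContinuousLinearMap.inl_apply,
        ContinuousLinearMap.inr_apply, ← map_add]
      simp
    rw [e]
    exact this
  have hB : HasDerivAt (fun ε : ℝ => (p + ε • r) (a + ε • w - c - ε • y))
      (r (a - c) + p (w - y)) 0 := by
    have e : (fun ε : ℝ => (p + ε • r) (a + ε • w - c - ε • y)) =
        fun ε : ℝ => p (a - c) + (ε * (r (a - c) + p (w - y)) + ε ^ 2 * r (w - y)) := by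
      funext ε
      simp only [ContinuousLinearMap.add_apply, ContinuousLinearMap.smul_apply, map_add, map_sub,
        map_smul, smul_eq_mul]
      ring
    rw [e]
    have := (((hasDerivAt_id (0 : ℝ)).mul_const (r (a - c) + p (w - y))).add
      (((hasDerivAt_id (0 : ℝ)).pow 2).mul_const (r (w - y)))).const_add (p (a - c))
    simpa using this
  rw [add_assoc (D1 L a b w + D2 L a b x)]
  exact hA.add hB

/-- The (−)-discrete Lagrange–d'Alembert–Pontryagin principle: criticality of
the (−)-discrete action sum with respect to constrained variations is
equivalent to the (−)-discrete Lagrange–d'Alembert–Pontryagin equations. -/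
theorem minus_discrete_LDAP_principle {n : ℕ} (h : ℝ) (hh : 0 < h)
    (Δ : (Fin n → ℝ) → Submodule ℝ (Fin n → ℝ))
    (L : (Fin n → ℝ) × (Fin n → ℝ) → ℝ) (hL : Differentiable ℝ L)
    (N : ℕ) (hN : 1 ≤ N)
    (q v : ℕ → Fin n → ℝ) (p : ℕ → (Fin n → ℝ) →L[ℝ] ℝ)
    (hcon : ∀ k < N, (v (k + 1), q (k + 1)) ∈ dMinus h Δ) :
    (∀ δq : ℕ → Fin n → ℝ, (∀ k ≤ N, δq k ∈ Δ (q k)) → δq 0 = 0 → δq N = 0 →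
      ∀ δv : ℕ → Fin n → ℝ, ∀ δp : ℕ → (Fin n → ℝ) →L[ℝ] ℝ,
        HasDerivAt (fun ε : ℝ => ∑ k ∈ Finset.range N,
          (L (v (k + 1) + ε • δv (k + 1), q (k + 1) + ε • δq (k + 1)) +
            (p k + ε • δp k)
              (v (k + 1) + ε • δv (k + 1) - q k - ε • δq k))) 0 0)
    ↔ ((∀ k < N, p k = - D1 L (v (k + 1)) (q (k + 1)) ∧ v (k + 1) = q k) ∧
       (∀ k : ℕ, k + 1 < N →
          p (k + 1) - D2 L (v (k + 1)) (q (k + 1)) ∈ ann Δ (q (k + 1)))) := by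
  have key : ∀ δq δv : ℕ → Fin n → ℝ, ∀ δp : ℕ → (Fin n → ℝ) →L[ℝ] ℝ,
      HasDerivAt (fun ε : ℝ => ∑ k ∈ Finset.range N,
          (L (v (k + 1) + ε • δv (k + 1), q (k + 1) + ε • δq (k + 1)) +
            (p k + ε • δp k)
              (v (k + 1) + ε • δv (k + 1) - q k - ε • δq k)))
        (∑ k ∈ Finset.range N, (D1 L (v (k + 1)) (q (k + 1)) (δv (k + 1)) +
          D2 L (v (k + 1)) (q (k + 1)) (δq (k + 1)) + δp k (v (k + 1) - q k) +
          p k (δv (k + 1) - δq k))) 0 := by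
    intro δq δv δp
    exact HasDerivAt.fun_sum fun k _ => aux_term L hL _ _ _ _ _ _ _ _
  constructor
  · intro H
    have H' : ∀ δq : ℕ → Fin n → ℝ, (∀ k ≤ N, δq k ∈ Δ (q k)) → δq 0 = 0 → δq N = 0 →
        ∀ δv : ℕ → Fin n → ℝ, ∀ δp : ℕ → (Fin n → ℝ) →L[ℝ] ℝ,
        (∑ k ∈ Finset.range N, (D1 L (v (k + 1)) (q (k + 1)) (δv (k + 1)) +
          D2 L (v (k + 1)) (q (k + 1)) (δq (k + 1)) + δp k (v (k + 1) - q k) +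
          p k (δv (k + 1) - δq k))) = 0 := fun δq a b c δv δp =>
      (key δq δv δp).unique (H δq a b c δv δp)
    refine ⟨fun k hk => ⟨?_, ?_⟩, fun k hk w hw => ?_⟩
    · ext1 w
      have := H' 0 (fun k _ => (Δ (q k)).zero_mem) rfl rfl (Pi.single (k + 1) w) 0
      rw [Finset.sum_eq_single k] at this
      · simp at this
        simp
        linarith
      · intro b _ hb
        have : b + 1 ≠ k + 1 := by omega
        simp [Pi.single_eq_of_ne this]
      · intro hb
        exact absurd (Finset.mem_range.2 hk) hb
    · funext i
      have := H' 0 (fun k _ => (Δ (q k)).zero_mem) rfl rfl 0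
        (Pi.single k (ContinuousLinearMap.proj i))
      rw [Finset.sum_eq_single k] at this
      · simp at this
        linarith
      · intro b _ hb
        simp [Pi.single_eq_of_ne hb]
      · intro hb
        exact absurd (Finset.mem_range.2 hk) hb
    · have := H' (Pi.single (k + 1) w) ?_ ?_ ?_ 0 0
      · simp only [Pi.zero_apply, map_zero, zero_add, add_zero, ContinuousLinearMap.zero_apply,
          zero_sub, map_neg, Finset.sum_add_distrib, Finset.sum_neg_distrib] at this
        rw [Finset.sum_eq_single k, Finset.sum_eq_single (k + 1)] at this
        · simp at this
          simp
          linarith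
        · intro b _ hb
          simp [Pi.single_eq_of_ne hb]
        · intro hb
          exact absurd (Finset.mem_range.2 hk) hb
        · intro b _ hb
          have : b + 1 ≠ k + 1 := by omega
          simp [Pi.single_eq_of_ne this]
        · intro hb
          exact absurd (Finset.mem_range.2 (by omega)) hb
      · intro j _
        by_cases hj : j = k + 1
        · subst hj
          simpa using hw
        · simp [Pi.single_eq_of_ne hj]
      · exact Pi.single_eq_of_ne (by omega) _
      · exact Pi.single_eq_of_ne (by omega) _
  · rintro ⟨h1, h2⟩ δq hq h0 hN0 δv δp
    convert key δq δv δp using 1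
    have : ∀ k ∈ Finset.range N, (D1 L (v (k + 1)) (q (k + 1)) (δv (k + 1)) +
          D2 L (v (k + 1)) (q (k + 1)) (δq (k + 1)) + δp k (v (k + 1) - q k) +
          p k (δv (k + 1) - δq k)) = p (k + 1) (δq (k + 1)) - p k (δq k) := by
      intro k hk
      have hk := Finset.mem_range.1 hk
      obtain ⟨ha, hb⟩ := h1 k hk
      have hD : D2 L (v (k + 1)) (q (k + 1)) (δq (k + 1)) = p (k + 1) (δq (k + 1)) := by
        rcases Nat.lt_or_ge (k + 1) N with hlt | hge
        · have := h2 k hlt _ (hq (k + 1) hlt.le)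
          rw [ContinuousLinearMap.sub_apply] at this
          linarith
        · have : k + 1 = N := by omega
          rw [this, hN0, map_zero, map_zero]
      have hP : p k (δv (k + 1)) = - D1 L (v (k + 1)) (q (k + 1)) (δv (k + 1)) := by
        rw [ha]; rfl
      have hz : δp k (v (k + 1) - q k) = 0 := by rw [hb, sub_self, map_zero]
      rw [hD, hz, map_sub, hP]
      ring
    rw [Finset.sum_congr rfl this, Finset.sum_range_sub (fun k => p k (δq k)), h0, hN0]
    simp
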